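/- arXiv:2004.04291 — 2 statements merged into one kernel-verified Lean document; each statement's English description precedes it below -/
import Mathlib

section
/- Let p and q be distinct primes with q > 2 and p ≡ 1 (mod q), let g be an element of multiplicative order q in (ℤ/p)ˣ, and let 2⁻¹ denote the inverse of 2 in ℤ/q. On the set B = ℤ/p × ℤ/p × ℤ/q with componentwise addition +, define (x₁,x₂,x₃) ∘ (y₁,y₂,y₃) = (x₁ + g^{x₃}·y₁ + g^{2⁻¹·x₃}·x₂·y₂, x₂ + g^{2⁻¹·x₃}·y₂, x₃ + y₃). Then (B,+,∘) is a left brace, the kernel of λ has order p, and (B,∘) is isomorphic to the semidirect product (ℤ/p × ℤ/p) ⋊ ℤ/q in which the generator 1 of ℤ/q acts by the diagonal matrix with entries g and g^{2⁻¹}. Moreover, up to brace isomorphism it is the unique left brace with additive group ℤ/p × ℤ/p × ℤ/q whose kernel of λ has order p. -/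
/-- `f` is a left-brace multiplication on the abelian group `B`: `(B, f)` is a group
with identity `0` and `f a (b + c) = f a b - a + f a c` holds. -/
def IsLeftBrace {B : Type*} [AddCommGroup B] (f : B → B → B) : Prop :=
  (∀ a b c, f (f a b) c = f a (f b c)) ∧
  (∀ a, f 0 a = a) ∧
  (∀ a, f a 0 = a) ∧
  (∀ a, ∃ a', f a' a = 0) ∧
  (∀ a b c, f a (b + c) = f a b - a + f a c)

/-- The kernel of `λ`: the set of `a` with `λ_a = id`, i.e. `a ∘ b = a + b` for all `b`. -/
def kerLambda {B : Type*} [AddCommGroup B] (f : B → B → B) : Set B :=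
  {a | ∀ b, f a b = a + b}

/-- The circle operation
`(x₁,x₂,x₃)∘(y₁,y₂,y₃) = (x₁ + g^{x₃} y₁ + g^{2⁻¹x₃} x₂ y₂, x₂ + g^{2⁻¹x₃} y₂, x₃+y₃)`
on `ℤ/p × ℤ/p × ℤ/q`, where `g` is a unit of `ℤ/p` and `2⁻¹` is inverted in `ℤ/q`. -/
def circ10 (p q : ℕ) (g : (ZMod p)ˣ) :
    ZMod p × ZMod p × ZMod q → ZMod p × ZMod p × ZMod q → ZMod p × ZMod p × ZMod q :=
  fun x y => (x.1 + (g : ZMod p) ^ (x.2.2).val * y.1 +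
                (g : ZMod p) ^ (((2 : ZMod q)⁻¹ * x.2.2)).val * x.2.1 * y.2.1,
              x.2.1 + (g : ZMod p) ^ (((2 : ZMod q)⁻¹ * x.2.2)).val * y.2.1,
              x.2.2 + y.2.2)

theorem pow_card_eq_one_of_map_eq_mul {A R : Type*} [Fintype A] [Field R] {f : A → A}
    (hf : f.Injective) {χ : A → R} (hχ : ∀ a, χ a ≠ 0) {c : R} (hc : ∀ a, χ (f a) = c * χ a) :
    c ^ Fintype.card A = 1 := by
  have h1 : ∏ a, χ (f a) = ∏ a, χ a :=
    Fintype.prod_bijective f (Finite.injective_iff_bijective.mp hf) _ _ (fun _ => rfl)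
  simp only [hc, Finset.prod_mul_distrib, Finset.prod_const, Finset.card_univ] at h1
  exact mul_right_cancel₀ (Finset.prod_ne_zero_iff.mpr fun a _ => hχ a) (h1.trans (one_mul _).symm)

theorem AddMonoidHom.zmod_eq_zero {p q : ℕ} (hpq : p.Coprime q) (f : ZMod p →+ ZMod q)
    (x : ZMod p) : f x = 0 := by
  have hx : p • f x = 0 := by
    rw [← map_nsmul, nsmul_eq_mul, ZMod.natCast_self, zero_mul, map_zero]
  have hunit : IsUnit ((p : ℕ) : ZMod q) := (ZMod.isUnit_iff_coprime p q).mpr hpq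
  rw [nsmul_eq_mul] at hx
  exact hunit.mul_right_eq_zero.mp hx

theorem AddMonoidHom.zmod_apply_eq_mul {p : ℕ} [NeZero p] (f : ZMod p →+ ZMod p) (x : ZMod p) :
    f x = f 1 * x := by
  conv_lhs => rw [← ZMod.natCast_zmod_val x, ← nsmul_one, map_nsmul, nsmul_eq_mul,
    ZMod.natCast_zmod_val, mul_comm]

namespace IsLeftBrace

variable {B : Type*} [AddCommGroup B] {f : B → B → B}

theorem exists_inverse (hf : IsLeftBrace f) (a : B) : ∃ a', f a' a = 0 ∧ f a a' = 0 := by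
  obtain ⟨hassoc, hl, hr, hinv, -⟩ := hf
  obtain ⟨a', ha'⟩ := hinv a
  obtain ⟨a'', ha''⟩ := hinv a'
  refine ⟨a', ha', ?_⟩
  have : a'' = a := by rw [← hr a'', ← ha', ← hassoc, ha'', hl]
  rwa [this] at ha''

theorem injective_left (hf : IsLeftBrace f) (a : B) : (f a).Injective := by
  intro b c hbc
  obtain ⟨a', ha', -⟩ := hf.exists_inverse a
  rw [← hf.2.1 b, ← hf.2.1 c, ← ha', hf.1, hf.1, hbc]

/-- The additive endomorphism `λ_a`. -/
def lam (hf : IsLeftBrace f) (a : B) : B →+ B where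
  toFun b := f a b - a
  map_zero' := by rw [hf.2.2.1, sub_self]
  map_add' b c := by rw [hf.2.2.2.2]; abel

theorem lam_apply (hf : IsLeftBrace f) (a b : B) : hf.lam a b = f a b - a := rfl

theorem eq_add_lam (hf : IsLeftBrace f) (a b : B) : f a b = a + hf.lam a b := by
  rw [lam_apply]; abel

theorem lam_zero (hf : IsLeftBrace f) (b : B) : hf.lam 0 b = b := by
  rw [lam_apply, hf.2.1, sub_zero]

theorem lam_mul (hf : IsLeftBrace f) (a b c : B) :
    hf.lam (f a b) c = hf.lam a (hf.lam b c) := by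
  rw [lam_apply, hf.1, hf.eq_add_lam a (f b c), hf.eq_add_lam b c, map_add, hf.eq_add_lam a b]
  abel

theorem mem_kerLambda_iff (hf : IsLeftBrace f) {a : B} :
    a ∈ kerLambda f ↔ ∀ b, hf.lam a b = b := by
  refine forall_congr' fun b => ?_
  rw [lam_apply, sub_eq_iff_eq_add, add_comm]

theorem lam_mem_kerLambda (hf : IsLeftBrace f) (a : B) {k : B} (hk : k ∈ kerLambda f) :
    hf.lam a k ∈ kerLambda f := by
  obtain ⟨a', ha', ha⟩ := hf.exists_inverse a
  have hz : f (f a k) a' ∈ kerLambda f := by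
    rw [hf.mem_kerLambda_iff] at hk ⊢
    intro b
    rw [hf.lam_mul, hf.lam_mul, hk, ← hf.lam_mul, ha, hf.lam_zero]
  have h1 : a + hf.lam a k = a + f (f a k) a' := by
    rw [← hf.eq_add_lam, add_comm, ← hz a, hf.1 _ a', ha', hf.2.2.1]
  rwa [add_left_cancel h1]

/-- The kernel of `λ` as an additive subgroup. -/
def kerAddSubgroup (hf : IsLeftBrace f) : AddSubgroup B where
  carrier := kerLambda f
  zero_mem' b := by rw [hf.2.1, zero_add]
  add_mem' {a b} ha hb c := by rw [← ha b, hf.1, ha, hb, ha, add_assoc]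
  neg_mem' {a} ha := by
    intro b
    obtain ⟨a', -, h⟩ := hf.exists_inverse a
    have h1 : a' = -a := by rw [ha a'] at h; exact (neg_eq_of_add_eq_zero_right h).symm
    apply hf.injective_left a
    rw [← hf.1, ← h1, h, hf.2.1, ha, h1]; abel

theorem lam_add_of_mem_kerLambda (hf : IsLeftBrace f) {k : B} (hk : k ∈ kerLambda f) (a b : B) :
    hf.lam (k + a) b = hf.lam a b := by
  rw [← hk a, hf.lam_mul, hf.mem_kerLambda_iff.mp hk]

/-- Transport of a brace multiplication along an additive automorphism. -/
theorem transport (hf : IsLeftBrace f) (e : B ≃+ B) :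
    IsLeftBrace fun a b => e (f (e.symm a) (e.symm b)) := by
  obtain ⟨hassoc, hl, hr, hinv, hd⟩ := hf
  refine ⟨fun a b c => ?_, fun a => ?_, fun a => ?_, fun a => ?_, fun a b c => ?_⟩
  · simp [hassoc]
  · simp [hl]
  · simp [hr]
  · obtain ⟨a', ha'⟩ := hinv (e.symm a)
    exact ⟨e a', by simp [ha']⟩
  · simp [hd]

theorem lam_character_pow (hf : IsLeftBrace f) [Fintype B] {R : Type*} [Field R] {χ : B → R}
    (h1 : χ 0 = 1) (hmul : ∀ a b, χ (f a b) = χ a * χ b) (a : B) :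
    χ a ≠ 0 ∧ χ a ^ Fintype.card B = 1 := by
  have hne : ∀ a, χ a ≠ 0 := fun a h0 => by
    obtain ⟨a', -, h⟩ := hf.exists_inverse a
    have := hmul a a'
    rw [h, h1, h0, zero_mul] at this
    exact one_ne_zero this
  exact ⟨hne a, pow_card_eq_one_of_map_eq_mul (hf.injective_left a) hne (hmul a)⟩

end IsLeftBrace

section Circ

variable {p q : ℕ}

theorem pow_val_add [NeZero q] {M : Type*} [Monoid M] {r : M} (hr : r ^ q = 1) (s t : ZMod q) :
    r ^ (s + t).val = r ^ s.val * r ^ t.val := by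
  rw [ZMod.val_add, ← pow_eq_pow_mod _ hr, pow_add]

theorem pow_val_natCast_mul [NeZero q] {M : Type*} [Monoid M] {r : M} (hr : r ^ q = 1)
    (m : ℕ) (s : ZMod q) : r ^ ((m : ZMod q) * s).val = (r ^ m) ^ s.val := by
  rw [← pow_mul, ← ZMod.natCast_zmod_val s, ← Nat.cast_mul, ZMod.val_natCast, ZMod.val_natCast,
    ← pow_eq_pow_mod _ hr, Nat.mod_eq_of_lt (ZMod.val_lt s)]

/-- The character `s ↦ g ^ (2⁻¹ s)` of `ℤ/q`. -/
def halfChar (p q : ℕ) (g : (ZMod p)ˣ) (s : ZMod q) : ZMod p :=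
  (g : ZMod p) ^ ((2 : ZMod q)⁻¹ * s).val

variable {g : (ZMod p)ˣ}

theorem halfChar_add [NeZero q] (hg : orderOf g = q) (s t : ZMod q) :
    halfChar p q g (s + t) = halfChar p q g s * halfChar p q g t := by
  have hgq : (g : ZMod p) ^ q = 1 := by
    rw [← Units.val_pow_eq_pow_val, ← hg, pow_orderOf_eq_one, Units.val_one]
  rw [halfChar, mul_add, pow_val_add hgq]; rfl

theorem halfChar_zero : halfChar p q g 0 = 1 := by simp [halfChar]

theorem two_ne_zero_zmod (hq2 : 2 < q) : (2 : ZMod q) ≠ 0 := by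
  have h : ((2 : ℕ) : ZMod q) ≠ 0 := by
    rw [Ne, ZMod.natCast_eq_zero_iff]
    exact fun h => absurd (Nat.le_of_dvd two_pos h) (by omega)
  exact_mod_cast h

theorem pow_val_eq_halfChar_sq [Fact q.Prime] (hq2 : 2 < q) (hg : orderOf g = q) (s : ZMod q) :
    (g : ZMod p) ^ s.val = halfChar p q g s ^ 2 := by
  have h2 := two_ne_zero_zmod hq2
  rw [sq, ← halfChar_add hg, halfChar, ← two_mul, inv_mul_cancel_left₀ h2]

theorem halfChar_eq_one [Fact q.Prime] (hq2 : 2 < q) (hg : orderOf g = q) {s : ZMod q}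
    (h : halfChar p q g s = 1) : s = 0 := by
  have h2 := two_ne_zero_zmod hq2
  rw [halfChar, ← Units.val_pow_eq_pow_val, Units.val_eq_one, ← orderOf_dvd_iff_pow_eq_one, hg,
    ← ZMod.natCast_eq_zero_iff, ZMod.natCast_zmod_val] at h
  simpa [h2] using h

theorem circ10_eq [Fact q.Prime] (hq2 : 2 < q) (hg : orderOf g = q)
    (x y : ZMod p × ZMod p × ZMod q) :
    circ10 p q g x y = (x.1 + halfChar p q g x.2.2 ^ 2 * y.1 + halfChar p q g x.2.2 * x.2.1 * y.2.1,
      x.2.1 + halfChar p q g x.2.2 * y.2.1, x.2.2 + y.2.2) := by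
  rw [← pow_val_eq_halfChar_sq hq2 hg]; rfl

theorem isLeftBrace_circ10 [Fact q.Prime] (hq2 : 2 < q) (hg : orderOf g = q) :
    IsLeftBrace (circ10 p q g) := by
  refine ⟨?_, ?_, ?_, ?_, ?_⟩
  · rintro ⟨a1, a2, a3⟩ ⟨b1, b2, b3⟩ ⟨c1, c2, c3⟩
    simp only [circ10_eq hq2 hg, halfChar_add hg, Prod.mk.injEq]
    refine ⟨by ring, by ring, by ring⟩
  · rintro ⟨a1, a2, a3⟩
    simp [circ10_eq hq2 hg, halfChar_zero]
  · rintro ⟨a1, a2, a3⟩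
    simp [circ10_eq hq2 hg]
  · rintro ⟨a1, a2, a3⟩
    have h : halfChar p q g (-a3) * halfChar p q g a3 = 1 := by
      rw [← halfChar_add hg, neg_add_cancel, halfChar_zero]
    generalize hz : halfChar p q g (-a3) = z at h
    refine ⟨(-z ^ 2 * a1 + z ^ 2 * a2 ^ 2, -z * a2, -a3), ?_⟩
    simp only [circ10_eq hq2 hg, hz, Prod.mk_eq_zero]
    refine ⟨by ring, by ring, by ring⟩
  · rintro ⟨a1, a2, a3⟩ ⟨b1, b2, b3⟩ ⟨c1, c2, c3⟩
    simp only [circ10_eq hq2 hg, Prod.mk_add_mk, Prod.mk_sub_mk, Prod.mk.injEq]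
    refine ⟨by ring, by ring, by ring⟩

theorem mem_kerLambda_circ10 [Fact p.Prime] [Fact q.Prime] (hq2 : 2 < q) (hg : orderOf g = q)
    (a : ZMod p × ZMod p × ZMod q) : a ∈ kerLambda (circ10 p q g) ↔ a.2 = 0 := by
  obtain ⟨a1, a2, a3⟩ := a
  simp only [kerLambda, Set.mem_ofPred_eq, circ10_eq hq2 hg, Prod.mk_eq_zero]
  constructor
  · intro h
    have h1 := h (0, 1, 0)
    simp only [mul_zero, add_zero, mul_one, Prod.mk_add_mk, Prod.mk.injEq, add_eq_left,
      add_right_inj, and_true] at h1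
    obtain ⟨h2, h3⟩ := h1
    rw [h3, one_mul] at h2
    exact ⟨h2, halfChar_eq_one hq2 hg h3⟩
  · rintro ⟨rfl, rfl⟩ b
    ext <;> simp [halfChar_zero]

theorem card_kerLambda_circ10 [Fact p.Prime] [Fact q.Prime] (hq2 : 2 < q)
    (hg : orderOf g = q) : Nat.card ↥(kerLambda (circ10 p q g)) = p := by
  let e : ↥(kerLambda (circ10 p q g)) ≃ ZMod p :=
    { toFun a := a.1.1
      invFun x := ⟨(x, 0), (mem_kerLambda_circ10 hq2 hg _).mpr rfl⟩
      left_inv a := Subtype.ext (Prod.ext rfl ((mem_kerLambda_circ10 hq2 hg _).mp a.2).symm)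
      right_inv _ := rfl }
  rw [Nat.card_congr e, Nat.card_zmod]

theorem exists_equiv_semidirect [Fact p.Prime] [Fact q.Prime] (hp2 : 2 < p) (hq2 : 2 < q)
    (hg : orderOf g = q) :
    ∃ e : ZMod p × ZMod p × ZMod q ≃ ZMod p × ZMod p × ZMod q,
      ∀ a b, e (circ10 p q g a b) =
        ((e a).1 + (g : ZMod p) ^ ((e a).2.2).val * (e b).1,
         (e a).2.1 + (g : ZMod p) ^ (((2 : ZMod q)⁻¹ * (e a).2.2)).val * (e b).2.1,
         (e a).2.2 + (e b).2.2) := by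
  have h2 := two_ne_zero_zmod hp2
  refine ⟨{ toFun x := (x.1 - x.2.1 ^ 2 / 2, x.2), invFun x := (x.1 + x.2.1 ^ 2 / 2, x.2),
            left_inv x := by simp, right_inv x := by simp }, fun a b => ?_⟩
  change _ = (_ + _ * _, _ + halfChar p q g _ * _, _)
  simp only [circ10_eq hq2 hg, Equiv.coe_fn_mk, pow_val_eq_halfChar_sq hq2 hg, Prod.mk.injEq,
    and_true]
  field_simp
  ring

end Circ

section Uniqueness

variable {p q : ℕ} [Fact p.Prime] [Fact q.Prime]
  {h : ZMod p × ZMod p × ZMod q → ZMod p × ZMod p × ZMod q → ZMod p × ZMod p × ZMod q}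

theorem card_zmod_prod : Fintype.card (ZMod p × ZMod p × ZMod q) = p * p * q := by
  simp [Fintype.card_prod, ZMod.card, mul_assoc]

namespace IsLeftBrace

/-- `λ_a` is trivial on the third factor. -/
theorem lam_trd (hqp : q < p) (hh : IsLeftBrace h) (a b : ZMod p × ZMod p × ZMod q) :
    (hh.lam a b).2.2 = b.2.2 := by
  have hcop : p.Coprime q :=
    (Nat.coprime_primes Fact.out Fact.out).mpr hqp.ne'
  have key : ∀ a b, (hh.lam a b).2.2 = (hh.lam a (0, 0, 1)).2.2 * b.2.2 := by
    rintro a ⟨b1, b2, b3⟩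
    let π : ZMod p × ZMod p × ZMod q →+ ZMod q :=
      (AddMonoidHom.snd _ _).comp (AddMonoidHom.snd _ _)
    have e1 := ((π.comp (hh.lam a)).comp (AddMonoidHom.inl _ _)).zmod_eq_zero hcop b1
    have e2 := (((π.comp (hh.lam a)).comp (AddMonoidHom.inr _ _)).comp
      (AddMonoidHom.inl _ _)).zmod_eq_zero hcop b2
    have e3 := (((π.comp (hh.lam a)).comp (AddMonoidHom.inr _ _)).comp
      (AddMonoidHom.inr _ _)).zmod_apply_eq_mul b3
    simp only [π, AddMonoidHom.comp_apply, AddMonoidHom.inl_apply, AddMonoidHom.inr_apply,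
      AddMonoidHom.coe_snd] at e1 e2 e3
    have : ((b1, b2, b3) : ZMod p × ZMod p × ZMod q) = (b1, 0) + ((0, b2, 0) + (0, 0, b3)) := by
      simp
    rw [this, map_add, map_add, Prod.snd_add, Prod.snd_add, Prod.snd_add, Prod.snd_add, e1, e2, e3]
    simp
  obtain ⟨hne, hpow⟩ := hh.lam_character_pow (χ := fun a => (hh.lam a (0, 0, 1)).2.2)
    (by simp [hh.lam_zero]) (fun a b => by simp only [hh.lam_mul]; rw [key a]) a
  rw [card_zmod_prod, mul_comm, pow_mul, ZMod.pow_card] at hpow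
  have h3 := ZMod.pow_card_sub_one_eq_one hne
  have hq : 2 ≤ q := (Fact.out : q.Prime).two_le
  have hcop' : (p * p).gcd (q - 1) = 1 := by
    have : p.Coprime (q - 1) := (Nat.Prime.coprime_iff_not_dvd Fact.out).mpr
      fun hd => absurd (Nat.le_of_dvd (by omega) hd) (by omega)
    exact Nat.Coprime.mul_left this this
  have h4 := pow_gcd_eq_one.mpr ⟨hpow, h3⟩
  rw [hcop', pow_one] at h4
  rw [key, h4, one_mul]

theorem exists_coefficients (hqp : q < p) (hh : IsLeftBrace h)
    (hK : ∀ a, a ∈ kerLambda h ↔ a.2 = 0) :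
    ∃ α β γ : ZMod p × ZMod p × ZMod q → ZMod p, ∀ a b,
      hh.lam a b = (α a * b.1 + γ a * b.2.1, β a * b.2.1, b.2.2) := by
  have hcop : q.Coprime p :=
    (Nat.coprime_primes Fact.out Fact.out).mpr hqp.ne
  refine ⟨fun a => (hh.lam a (1, 0)).1, fun a => (hh.lam a (0, 1, 0)).2.1,
    fun a => (hh.lam a (0, 1, 0)).1, fun a b => ?_⟩
  have e0 : (hh.lam a (b.1, 0)).2 = 0 := (hK _).mp (hh.lam_mem_kerLambda a ((hK _).mpr rfl))
  let π₁ : ZMod p × ZMod p × ZMod q →+ ZMod p := AddMonoidHom.fst _ _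
  let π₂ : ZMod p × ZMod p × ZMod q →+ ZMod p :=
    (AddMonoidHom.fst _ _).comp (AddMonoidHom.snd _ _)
  have e1 := ((π₁.comp (hh.lam a)).comp (AddMonoidHom.inl _ _)).zmod_apply_eq_mul b.1
  have e2 := (((π₁.comp (hh.lam a)).comp (AddMonoidHom.inr _ _)).comp
      (AddMonoidHom.inl _ _)).zmod_apply_eq_mul b.2.1
  have e3 := (((π₂.comp (hh.lam a)).comp (AddMonoidHom.inr _ _)).comp
      (AddMonoidHom.inl _ _)).zmod_apply_eq_mul b.2.1
  have e4 := (((π₁.comp (hh.lam a)).comp (AddMonoidHom.inr _ _)).comp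
      (AddMonoidHom.inr _ _)).zmod_eq_zero hcop b.2.2
  have e5 := (((π₂.comp (hh.lam a)).comp (AddMonoidHom.inr _ _)).comp
      (AddMonoidHom.inr _ _)).zmod_eq_zero hcop b.2.2
  simp only [π₁, π₂, AddMonoidHom.comp_apply, AddMonoidHom.inl_apply, AddMonoidHom.inr_apply,
      AddMonoidHom.coe_snd, AddMonoidHom.coe_fst] at e1 e2 e3 e4 e5
  have hb : b = (b.1, 0) + ((0, b.2.1, 0) + (0, 0, b.2.2)) := by simp
  have ht := hh.lam_trd hqp a b
  refine Prod.ext ?_ (Prod.ext ?_ ht)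
  · conv_lhs => rw [hb]
    simp only [map_add, Prod.fst_add, e1, e2, e4, add_zero]
  · conv_lhs => rw [hb]
    simp only [map_add, Prod.fst_add, Prod.snd_add, e0, e3, e5, add_zero, zero_add]

/-- A normal form for braces whose `λ`-kernel is the first factor. -/
theorem exists_normal_form (hqp : q < p) (hh : IsLeftBrace h)
    (hK : ∀ a, a ∈ kerLambda h ↔ a.2 = 0) :
    ∃ (χ : ZMod q → ZMod p) (c τ : ZMod p), c ≠ 0 ∧ χ 1 ≠ 1 ∧ χ 1 ^ q = 1 ∧
      (∀ s t, χ (s + t) = χ s * χ t) ∧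
      ∀ a b, h a b = (a.1 + χ a.2.2 ^ 2 * b.1 +
          (τ * (χ a.2.2 ^ 2 - χ a.2.2) + c * a.2.1 * χ a.2.2) * b.2.1,
        a.2.1 + χ a.2.2 * b.2.1, a.2.2 + b.2.2) := by
  obtain ⟨α, β, γ, hL⟩ := hh.exists_coefficients hqp hK
  have hmul : ∀ a b, h a b = (a.1 + (α a * b.1 + γ a * b.2.1), a.2.1 + β a * b.2.1,
      a.2.2 + b.2.2) := fun a b => by rw [hh.eq_add_lam, hL]; rfl
  have hαβγ0 : α 0 = 1 ∧ β 0 = 1 := by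
    have h1 := hL 0 (1, 0, 0)
    have h2 := hL 0 (0, 1, 0)
    simp only [hh.lam_zero, Prod.mk.injEq] at h1 h2
    exact ⟨by simpa using h1.1.symm, by simpa using h2.2.1.symm⟩
  have hα : ∀ a b, α (h a b) = α a * α b := fun a b => by
    have h1 := hh.lam_mul a b (1, 0, 0)
    simp only [hL, Prod.mk.injEq] at h1
    simpa using h1.1
  have hβγ : ∀ a b, β (h a b) = β a * β b ∧ γ (h a b) = α a * γ b + γ a * β b := fun a b => by
    have h1 := hh.lam_mul a b (0, 1, 0)
    simp only [hL, Prod.mk.injEq] at h1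
    exact ⟨by simpa using h1.2.1, by simpa using h1.1⟩
  have hβ := fun a b => (hβγ a b).1
  have hγ := fun a b => (hβγ a b).2
  have hshift : ∀ x y, α (x, y) = α (0, y) ∧ β (x, y) = β (0, y) ∧ γ (x, y) = γ (0, y) := by
    intro x y
    have hk := hh.lam_add_of_mem_kerLambda ((hK (x, 0)).mpr rfl) (0, y)
    have h1 := hk (1, 0, 0)
    have h2 := hk (0, 1, 0)
    simp only [hL, Prod.mk_add_mk, add_zero, zero_add, Prod.mk.injEq, mul_one, mul_zero] at h1 h2
    exact ⟨h1.1, h2.2.1, h2.1⟩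
  have hne : ∀ a, α a ≠ 0 ∧ β a ≠ 0 := fun a =>
    ⟨(hh.lam_character_pow hαβγ0.1 hα a).1, (hh.lam_character_pow hαβγ0.2 hβ a).1⟩
  have hβq : ∀ a, β a ^ q = 1 := fun a => by
    have := (hh.lam_character_pow hαβγ0.2 hβ a).2
    rwa [card_zmod_prod, pow_mul, pow_mul, ZMod.pow_card, ZMod.pow_card] at this
  have hP : ∀ x y : ZMod p, h (0, x, 0) (0, y, 0) =
      (γ (0, x, 0) * y, x + β (0, x, 0) * y, 0) := fun x y => by simp [hmul]
  have hinj : ∀ x, (fun y : ZMod p => x + β (0, x, 0) * y).Injective := fun x y z hyz =>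
    mul_left_cancel₀ (hne (0, x, 0)).2 (add_left_cancel hyz)
  have hβ1 : ∀ x, β (0, x, 0) = 1 := fun x => by
    have := pow_card_eq_one_of_map_eq_mul (hinj x) (χ := fun y => β (0, y, 0))
      (fun y => (hne _).2) (c := β (0, x, 0))
      (fun y => by rw [← hβ, hP, (hshift (_ * _) _).2.1])
    rwa [ZMod.card, ZMod.pow_card] at this
  have hα1 : ∀ x, α (0, x, 0) = 1 := fun x => by
    have := pow_card_eq_one_of_map_eq_mul (hinj x) (χ := fun y => α (0, y, 0))
      (fun y => (hne _).1) (c := α (0, x, 0))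
      (fun y => by rw [← hα, hP, (hshift (_ * _) _).1])
    rwa [ZMod.card, ZMod.pow_card] at this
  obtain ⟨c, hc⟩ : ∃ c, ∀ x, γ (0, x, 0) = c * x := by
    let φ : ZMod p →+ ZMod p := AddMonoidHom.mk' (fun x => γ (0, x, 0)) fun x y => by
      have := hγ (0, x, 0) (0, y, 0)
      rw [hP, (hshift (_ * _) _).2.2, hβ1, hβ1, hα1] at this
      rw [one_mul, one_mul, mul_one] at this
      rw [this, add_comm]
    exact ⟨φ 1, φ.zmod_apply_eq_mul⟩
  have hc0 : c ≠ 0 := by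
    rintro rfl
    have : ((0, 1, 0) : ZMod p × ZMod p × ZMod q) ∈ kerLambda h := by
      rw [hh.mem_kerLambda_iff]
      intro b
      rw [hL, hα1, hβ1, hc]
      simp
    have := (hK _).mp this
    simp at this
  have hσ : ∀ s t : ZMod q, h (0, 0, s) (0, 0, t) = (0, 0, s + t) := fun s t => by simp [hmul]
  have hgen : ∀ x s, h (0, x, 0) (0, 0, s) = (0, x, s) := fun x s => by simp [hmul]
  have hαx : ∀ x s, α (0, x, s) = α (0, 0, s) := fun x s => by rw [← hgen, hα, hα1, one_mul]
  have hβx : ∀ x s, β (0, x, s) = β (0, 0, s) := fun x s => by rw [← hgen, hβ, hβ1, one_mul]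
  have hγx : ∀ x s, γ (0, x, s) = γ (0, 0, s) + c * x * β (0, 0, s) := fun x s => by
    rw [← hgen, hγ, hα1, hc, one_mul]
  have hsq : ∀ s, α (0, 0, s) = β (0, 0, s) ^ 2 := fun s => by
    have h1 := hγ (0, 0, s) (0, 1, 0)
    have h2 : h (0, 0, s) (0, 1, 0) = (γ (0, 0, s), β (0, 0, s), s) := by simp [hmul]
    rw [h2, (hshift _ _).2.2, hγx, hc, hβ1] at h1
    apply mul_left_cancel₀ hc0
    linear_combination -h1
  have hχadd : ∀ s t, β (0, 0, s + t) = β (0, 0, s) * β (0, 0, t) := fun s t => by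
    rw [← hβ, hσ]
  have hδ : ∀ s t, γ (0, 0, s + t) =
      β (0, 0, s) ^ 2 * γ (0, 0, t) + γ (0, 0, s) * β (0, 0, t) := fun s t => by
    rw [← hsq, ← hγ, hσ]
  have hχ1 : β (0, 0, 1) ≠ 1 := by
    intro h1
    have hβs : ∀ s, β (0, 0, s) = 1 := fun s => by
      rw [← ZMod.natCast_zmod_val s]
      induction s.val with
      | zero => simpa using hβ1 0
      | succ n ih => rw [Nat.cast_succ, hχadd, ih, h1, one_mul]
    let φ : ZMod q →+ ZMod p := AddMonoidHom.mk' (fun s => γ (0, 0, s)) fun s t => by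
      rw [hδ, hβs, hβs]; ring
    have hφ : γ (0, 0, 1) = 0 :=
      φ.zmod_eq_zero ((Nat.coprime_primes Fact.out Fact.out).mpr hqp.ne) 1
    have : ((0, 0, 1) : ZMod p × ZMod p × ZMod q) ∈ kerLambda h := by
      rw [hh.mem_kerLambda_iff]
      intro b
      rw [hL, hsq, h1, hφ]
      simp
    have := (hK _).mp this
    simp at this
  have hχ0 := (hne (0, 0, 1)).2
  have hd : β (0, 0, 1) ^ 2 - β (0, 0, 1) ≠ 0 := by
    rw [sq, ← mul_sub_one]
    exact mul_ne_zero hχ0 (sub_ne_zero.mpr hχ1)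
  refine ⟨fun s => β (0, 0, s), c, γ (0, 0, 1) / (β (0, 0, 1) ^ 2 - β (0, 0, 1)), hc0, hχ1,
    hβq _, hχadd, ?_⟩
  rintro ⟨a1, a2, a3⟩ b
  have hτ : γ (0, 0, a3) = γ (0, 0, 1) / (β (0, 0, 1) ^ 2 - β (0, 0, 1)) *
      (β (0, 0, a3) ^ 2 - β (0, 0, a3)) := by
    have h1 := hδ 1 a3
    rw [add_comm, hδ] at h1
    rw [div_mul_eq_mul_div, eq_div_iff hd]
    linear_combination -h1
  obtain ⟨e1, e2, e3⟩ := hshift a1 (a2, a3)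
  rw [hmul, e1, e2, e3, hαx, hβx, hγx, hsq, hτ, Prod.mk.injEq]
  exact ⟨by ring, rfl⟩

theorem exists_equiv_circ10_of_ker (hqp : q < p) (hq2 : 2 < q) {g : (ZMod p)ˣ}
    (hg : orderOf g = q) (hh : IsLeftBrace h) (hK : ∀ a, a ∈ kerLambda h ↔ a.2 = 0) :
    ∃ e : ZMod p × ZMod p × ZMod q ≃+ ZMod p × ZMod p × ZMod q,
      ∀ a b, e (h a b) = circ10 p q g (e a) (e b) := by
  obtain ⟨χ, c, τ, hc, hχ1, hχq, hχadd, hform⟩ := hh.exists_normal_form hqp hK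
  have hprim : IsPrimitiveRoot (g : ZMod p) q := by
    rw [IsPrimitiveRoot.coe_units_iff, ← hg]; exact IsPrimitiveRoot.orderOf g
  obtain ⟨m, -, hm⟩ := hprim.eq_pow_of_pow_eq_one hχq
  have h2 := two_ne_zero_zmod hq2
  have hm0 : (m : ZMod q) ≠ 0 := by
    intro h0
    rw [ZMod.natCast_eq_zero_iff, ← hprim.pow_eq_one_iff_dvd, hm] at h0
    exact hχ1 h0
  have hχ0 : χ 0 = 1 := by
    have h1 := hχadd 0 1
    rw [zero_add] at h1
    have : χ 1 ≠ 0 := fun h0 => by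
      rw [h0, zero_pow (Fact.out : q.Prime).ne_zero] at hχq
      exact zero_ne_one hχq
    exact mul_right_cancel₀ this (h1.symm.trans (one_mul _).symm)
  have hχpow : ∀ n : ℕ, χ n = χ 1 ^ n := fun n => by
    induction n with
    | zero => simpa using hχ0
    | succ n ih => rw [Nat.cast_succ, hχadd, ih, pow_succ]
  have hhalf : ∀ s, halfChar p q g (2 * m * s) = χ s := fun s => by
    rw [halfChar, mul_assoc, inv_mul_cancel_left₀ h2, pow_val_natCast_mul hprim.pow_eq_one, hm,
      ← hχpow, ZMod.natCast_zmod_val]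
  have hn : (2 * m : ZMod q) ≠ 0 := mul_ne_zero h2 hm0
  refine ⟨{ toFun x := (c⁻¹ * (x.1 + τ * x.2.1), x.2.1, 2 * m * x.2.2)
            invFun x := (c * x.1 - τ * x.2.1, x.2.1, (2 * m : ZMod q)⁻¹ * x.2.2)
            left_inv x := by
              ext
              · simp [mul_inv_cancel_left₀ hc]
              · rfl
              · exact inv_mul_cancel_left₀ hn _
            right_inv x := by
              ext
              · simp [inv_mul_cancel_left₀ hc]
              · rfl
              · exact mul_inv_cancel_left₀ hn _
            map_add' x y := by
              ext
              · simp; ring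
              · rfl
              · simp; ring }, fun a b => ?_⟩
  simp only [AddEquiv.coe_mk, Equiv.coe_fn_mk, circ10_eq hq2 hg, hhalf, hform, Prod.mk.injEq,
    true_and]
  refine ⟨?_, by ring⟩
  field_simp
  ring

/-- A `λ`-kernel of order `p` can be moved to the first factor. -/
theorem exists_addEquiv_ker (hqp : q < p) (hh : IsLeftBrace h)
    (hcard : Nat.card ↥(kerLambda h) = p) :
    ∃ θ : ZMod p × ZMod p × ZMod q ≃+ ZMod p × ZMod p × ZMod q,
      ∀ a, θ.symm a ∈ kerLambda h ↔ a.2 = 0 := by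
  have hcardK : Nat.card hh.kerAddSubgroup = p := hcard
  have hp1 : 1 < p := (Fact.out : p.Prime).one_lt
  obtain ⟨⟨k, hk⟩, hk0⟩ : ∃ k : hh.kerAddSubgroup, k ≠ 0 := by
    have : Nontrivial hh.kerAddSubgroup := by
      rw [← Finite.one_lt_card_iff_nontrivial, hcardK]; exact hp1
    exact exists_ne 0
  obtain ⟨u, v, w⟩ := k
  have hw : w = 0 := by
    have h1 : Nat.card hh.kerAddSubgroup • (⟨(u, v, w), hk⟩ : hh.kerAddSubgroup) = 0 :=
      card_nsmul_eq_zero'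
    rw [hcardK] at h1
    have h2 : p • w = 0 := congrArg (fun x : hh.kerAddSubgroup => x.1.2.2) h1
    rw [nsmul_eq_mul] at h2
    refine (mul_eq_zero.mp h2).resolve_left ?_
    rw [ZMod.natCast_eq_zero_iff, Nat.prime_dvd_prime_iff_eq Fact.out Fact.out]
    exact hqp.ne
  subst hw
  have huv : u ≠ 0 ∨ v ≠ 0 := by
    by_contra! hcon
    exact hk0 (by simp [hcon.1, hcon.2])
  obtain ⟨s, t, hst⟩ : ∃ s t, s * u + t * v = 1 := by
    rcases huv with hu | hv
    · exact ⟨u⁻¹, 0, by simp [hu]⟩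
    · exact ⟨0, v⁻¹, by simp [hv]⟩
  let θ : ZMod p × ZMod p × ZMod q ≃+ ZMod p × ZMod p × ZMod q :=
    { toFun x := (s * x.1 + t * x.2.1, u * x.2.1 - v * x.1, x.2.2)
      invFun x := (u * x.1 - t * x.2.1, v * x.1 + s * x.2.1, x.2.2)
      left_inv x := by
        refine Prod.ext ?_ (Prod.ext ?_ rfl)
        · linear_combination x.1 * hst
        · linear_combination x.2.1 * hst
      right_inv x := by
        refine Prod.ext ?_ (Prod.ext ?_ rfl)
        · linear_combination x.1 * hst
        · linear_combination x.2.1 * hst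
      map_add' x y := by
        refine Prod.ext ?_ (Prod.ext ?_ rfl)
        · simp; ring
        · simp; ring }
  have hmem : ∀ x : ZMod p, θ.symm (x, 0) ∈ kerLambda h := fun x => by
    have h1 := hh.kerAddSubgroup.nsmul_mem hk x.val
    have h2 : x.val • ((u, v, 0) : ZMod p × ZMod p × ZMod q) = θ.symm (x, 0) := by
      change _ = (u * x - t * 0, v * x + s * 0, (0 : ZMod q))
      simp [mul_comm]
    rw [h2] at h1
    exact h1
  refine ⟨θ, fun a => ⟨fun ha => ?_, fun ha => ?_⟩⟩
  · let ψ : ZMod p → ↥(kerLambda h) := fun x => ⟨θ.symm (x, 0), hmem x⟩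
    have hψ : ψ.Injective := fun x y hxy =>
      congrArg Prod.fst (θ.symm.injective (congrArg Subtype.val hxy))
    have hbij : ψ.Bijective :=
      (Nat.bijective_iff_injective_and_card ψ).mpr ⟨hψ, by rw [hcard, Nat.card_zmod]⟩
    obtain ⟨x, hx⟩ := hbij.2 ⟨_, ha⟩
    rw [← θ.symm.injective (congrArg Subtype.val hx)]
  · have := hmem a.1
    rwa [show (a.1, 0) = a from Prod.ext rfl ha.symm] at this

theorem exists_equiv_circ10 (hqp : q < p) (hq2 : 2 < q) {g : (ZMod p)ˣ}
    (hg : orderOf g = q) (hh : IsLeftBrace h) (hcard : Nat.card ↥(kerLambda h) = p) :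
    ∃ e : ZMod p × ZMod p × ZMod q ≃ ZMod p × ZMod p × ZMod q,
      (∀ a b, e (a + b) = e a + e b) ∧ ∀ a b, e (h a b) = circ10 p q g (e a) (e b) := by
  obtain ⟨θ, hθ⟩ := hh.exists_addEquiv_ker hqp hcard
  obtain ⟨e, he⟩ := (hh.transport θ).exists_equiv_circ10_of_ker hqp hq2 hg fun a => by
    rw [← hθ]
    constructor
    · intro ha b
      have := ha (θ b)
      rw [← θ.symm.injective.eq_iff] at this
      simpa using this
    · intro ha b
      simp only [ha _, map_add, AddEquiv.apply_symm_apply]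
  refine ⟨(θ.trans e).toEquiv, (θ.trans e).map_add, fun a b => ?_⟩
  have := he (θ a) (θ b)
  simpa using this

end IsLeftBrace

end Uniqueness

/-- Let `p, q` be distinct primes with `q > 2` and `p ≡ 1 (mod q)`, and let `g` have
order `q` in `(ℤ/p)ˣ`.  On `B = ℤ/p × ℤ/p × ℤ/q` the displayed operation makes
`(B,+,∘)` a left brace with `|ker λ| = p`; `(B,∘)` is isomorphic to
`(ℤ/p × ℤ/p) ⋊ ℤ/q` where the generator `1` of `ℤ/q` acts by `diag(g, g^{2⁻¹})`;
and up to brace isomorphism it is the unique left brace with additive group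
`ℤ/p × ℤ/p × ℤ/q` and `|ker λ| = p`. -/
theorem stmt_10 (p q : ℕ) (hp : p.Prime) (hq : q.Prime) (hpq : p ≠ q) (hq2 : 2 < q)
    (hmod : p ≡ 1 [MOD q]) (g : (ZMod p)ˣ) (hg : orderOf g = q) :
    IsLeftBrace (circ10 p q g) ∧
    Nat.card ↥(kerLambda (circ10 p q g)) = p ∧
    (∃ e : ZMod p × ZMod p × ZMod q ≃ ZMod p × ZMod p × ZMod q,
      ∀ a b, e (circ10 p q g a b) =
        ((e a).1 + (g : ZMod p) ^ ((e a).2.2).val * (e b).1,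
         (e a).2.1 + (g : ZMod p) ^ (((2 : ZMod q)⁻¹ * (e a).2.2)).val * (e b).2.1,
         (e a).2.2 + (e b).2.2)) ∧
    (∀ h : ZMod p × ZMod p × ZMod q → ZMod p × ZMod p × ZMod q → ZMod p × ZMod p × ZMod q,
      IsLeftBrace h → Nat.card ↥(kerLambda h) = p →
      ∃ e : ZMod p × ZMod p × ZMod q ≃ ZMod p × ZMod p × ZMod q,
        (∀ a b, e (a + b) = e a + e b) ∧
        ∀ a b, e (h a b) = circ10 p q g (e a) (e b)) := by
  have : Fact p.Prime := ⟨hp⟩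
  have : Fact q.Prime := ⟨hq⟩
  have hqp : q < p := by
    have hd : q ∣ p - 1 := (Nat.modEq_iff_dvd' hp.one_le).mp hmod.symm
    have := Nat.le_of_dvd (Nat.sub_pos_of_lt hp.one_lt) hd
    omega
  exact ⟨isLeftBrace_circ10 hq2 hg, card_kerLambda_circ10 hq2 hg,
    exists_equiv_semidirect (hq2.trans hqp) hq2 hg,
    fun h hh hcard => hh.exists_equiv_circ10 hqp hq2 hg hcard⟩
end

section
/- Let p be an odd prime. On the set B = ℤ/p × ℤ/p × ℤ/2 with componentwise addition +, define (x₁,x₂,x₃) ∘ (y₁,y₂,y₃) = (x₁ + y₁ + (−1)^{x₃}·x₂·y₂, x₂ + (−1)^{x₃}·y₂, x₃ + y₃). Then (B,+,∘) is a left brace, the kernel of λ has order p, and (B,∘) is isomorphic to ℤ/p × D_{2p}, where D_{2p} is the dihedral group of order 2p. Moreover, up to brace isomorphism it is the unique left brace with additive group ℤ/p × ℤ/p × ℤ/2 whose kernel of λ has order p. -/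
/-- The circle operation
`(x₁,x₂,x₃)∘(y₁,y₂,y₃) = (x₁ + y₁ + (-1)^{x₃} x₂ y₂, x₂ + (-1)^{x₃} y₂, x₃ + y₃)`
on `ℤ/p × ℤ/p × ℤ/2`. -/
def circ11 (p : ℕ) :
    ZMod p × ZMod p × ZMod 2 → ZMod p × ZMod p × ZMod 2 → ZMod p × ZMod p × ZMod 2 :=
  fun x y => (x.1 + y.1 + (-1 : ZMod p) ^ (x.2.2).val * x.2.1 * y.2.1,
              x.2.1 + (-1 : ZMod p) ^ (x.2.2).val * y.2.1,
              x.2.2 + y.2.2)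

section PrimeSquare

variable {p : ℕ} [Fact p.Prime]

lemma map_smul_of_map_add {V W : Type*} [AddCommGroup V] [AddCommGroup W] [Module (ZMod p) V]
    [Module (ZMod p) W] {T : V → W} (hT : ∀ x y, T (x + y) = T x + T y) (k : ZMod p) (x : V) :
    T (k • x) = k • T x :=
  ZMod.map_smul (AddMonoidHom.mk' T hT) k x

/-- A brace structure on `(ℤ/p)²`, given by its `λ`-map `M`, whose circle group is commutative
and fixes the first basis vector. -/
lemma exists_eq_of_fixes_fst {M : ZMod p × ZMod p → ZMod p × ZMod p → ZMod p × ZMod p}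
    (hadd : ∀ x y z, M x (y + z) = M x y + M x z)
    (hcomm : ∀ x y, x + M x y = y + M y x)
    (hmul : ∀ x y z, M (x + M x y) z = M x (M y z))
    (hinj : ∀ x y, M x y = 0 → y = 0)
    (hfix : ∀ x, M x (1, 0) = (1, 0)) :
    ∃ c : ZMod p, ∀ x y, M x y = y + (c * x.2 * y.2, 0) := by
  have hsmul : ∀ x (k : ZMod p) y, M x (k • y) = k • M x y := fun x k y =>
    map_smul_of_map_add (hadd x) k y
  have hfix' : ∀ x (k : ZMod p), M x (k, 0) = (k, 0) := fun x k => by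
    have := hsmul x k (1, 0)
    rw [hfix] at this
    simpa using this
  have hker : ∀ (k : ZMod p) y, M (k, 0) y = y := fun k y => by
    have := hcomm (k, 0) y
    rw [hfix', add_comm y] at this
    exact add_left_cancel this
  have hdep : ∀ x, M x = M (0, x.2) := fun x => by
    funext z
    have := hmul (x.1, 0) (0, x.2) z
    rw [hker, hker] at this
    simpa using this
  obtain ⟨g, hg⟩ : ∃ g : ZMod p → ZMod p, ∀ t, g t = (M (0, t) (0, 1)).1 := ⟨_, fun _ => rfl⟩
  obtain ⟨u, hu⟩ : ∃ u : ZMod p → ZMod p, ∀ t, u t = (M (0, t) (0, 1)).2 := ⟨_, fun _ => rfl⟩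
  have hform : ∀ x y, M x y = (y.1 + y.2 * g x.2, y.2 * u x.2) := fun x y => by
    have h1 : y = (y.1, 0) + y.2 • ((0, 1) : ZMod p × ZMod p) := by ext <;> simp
    conv_lhs => rw [h1, hadd, hfix', hsmul, hdep]
    ext <;> simp [hg, hu]
  have hgu : ∀ s, g s = s * g 1 ∧ s + u s = 1 + s * u 1 := fun s => by
    have := hcomm (0, s) (0, 1)
    rw [hform, hform] at this
    simpa using this
  have hu1 : u 1 = 1 := by
    by_contra hne
    have hw : u 1 - 1 ≠ 0 := sub_ne_zero.mpr hne
    set s := -(u 1 - 1)⁻¹ with hs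
    have h0 : u s = 0 := by
      have h1 := (hgu s).2
      have h2 : s * (u 1 - 1) = -1 := by rw [hs, neg_mul, inv_mul_cancel₀ hw]
      linear_combination h1 + h2
    have := hinj (0, s) (-g s, 1) (by rw [hform]; simp [h0])
    simp at this
  refine ⟨g 1, fun x y => ?_⟩
  rw [hform]
  have h1 := (hgu x.2).1
  have h2 : u x.2 = 1 := by linear_combination (hgu x.2).2 + x.2 * hu1
  ext
  · simp only [Prod.fst_add, h1]; ring
  · simp [h2]

lemma exists_addEquiv_apply_eq {v : ZMod p × ZMod p} (hv : v ≠ 0) :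
    ∃ φ : (ZMod p × ZMod p) ≃+ (ZMod p × ZMod p), φ v = (1, 0) := by
  obtain ⟨a, b⟩ := v
  by_cases ha : a = 0
  · have hb : b ≠ 0 := by rintro rfl; exact hv (by simp [ha])
    refine ⟨⟨⟨fun x => (x.2 / b, x.1), fun x => (x.2, x.1 * b), ?_, ?_⟩, ?_⟩, ?_⟩
    · intro x; ext <;> simp [hb]
    · intro x; ext <;> simp [hb]
    · intro x y; ext <;> simp [add_div]
    · simp [ha, hb]
  · refine ⟨⟨⟨fun x => (x.1 / a, x.2 - b * (x.1 / a)), fun x => (x.1 * a, x.2 + b * x.1),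
      ?_, ?_⟩, ?_⟩, ?_⟩
    · intro x; ext <;> simp [ha]
    · intro x; ext <;> simp [ha]
    · intro x y
      ext
      · simp [add_div]
      · simp; ring
    · simp [ha]

/-- The circle group of a brace on `(ℤ/p)²` with `λ`-map `M`. -/
@[reducible] noncomputable def circleGroup {M : ZMod p × ZMod p → ZMod p × ZMod p → ZMod p × ZMod p}
    (hadd : ∀ x y z, M x (y + z) = M x y + M x z)
    (hmul : ∀ x y z, M (x + M x y) z = M x (M y z))
    (hone : ∀ y, M 0 y = y)
    (hinv : ∀ x, ∃ y, y + M y x = 0) : Group (ZMod p × ZMod p) :=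
  letI : Mul (ZMod p × ZMod p) := ⟨fun x y => x + M x y⟩
  letI : Inv (ZMod p × ZMod p) := ⟨fun x => (hinv x).choose⟩
  letI : One (ZMod p × ZMod p) := ⟨0⟩
  Group.ofLeftAxioms
    (fun x y z => by
      change (x + M x y) + M (x + M x y) z = x + M x (y + M y z)
      rw [hmul, hadd, add_assoc])
    (fun x => by
      change 0 + M 0 x = x
      rw [hone, zero_add])
    (fun x => (hinv x).choose_spec)

/-- A commutative circle group and a nonzero common fixed vector of the `λ`-map, for braces
on `(ℤ/p)²`. -/
lemma comm_and_exists_fixed {M : ZMod p × ZMod p → ZMod p × ZMod p → ZMod p × ZMod p}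
    (hadd : ∀ x y z, M x (y + z) = M x y + M x z)
    (hmul : ∀ x y z, M (x + M x y) z = M x (M y z))
    (hone : ∀ y, M 0 y = y)
    (hinv : ∀ x, ∃ y, y + M y x = 0) :
    (∀ x y, x + M x y = y + M y x) ∧ ∃ v ≠ 0, ∀ x, M x v = v := by
  have hcard : Nat.card (ZMod p × ZMod p) = p ^ 2 := by
    rw [Nat.card_prod, Nat.card_zmod, sq]
  have key : ∀ (G : Type) [Group G] (ι : G ≃ ZMod p × ZMod p),
      (∀ x y, ι (x * y) = ι x + M (ι x) (ι y)) → ι 1 = 0 →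
      (∀ x y, x + M x y = y + M y x) ∧ ∃ v ≠ 0, ∀ x, M x v = v := by
    intro G _ ι hι h1
    have hG : Nat.card G = p ^ 2 := (Nat.card_congr ι).trans hcard
    constructor
    · intro x y
      have := IsPGroup.isMulCommutative_of_card_eq_prime_sq hG
      have := congrArg ι (mul_comm' (ι.symm x) (ι.symm y))
      simpa [hι] using this
    · have hP : IsPGroup p G := IsPGroup.of_card hG
      let act : MulAction G (ZMod p × ZMod p) :=
        { smul := fun x y => M (ι x) y
          one_smul := fun y => by change M (ι 1) y = y; rw [h1, hone]
          mul_smul := fun x y z => by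
            change M (ι (x * y)) z = M (ι x) (M (ι y) z)
            rw [hι, hmul] }
      obtain ⟨v, hv, hne⟩ := hP.exists_fixed_point_of_prime_dvd_card_of_fixed_point
        (ZMod p × ZMod p) (by rw [hcard]; exact dvd_pow_self p two_ne_zero) (a := 0)
        (fun x => by
          change M (ι x) 0 = 0
          simpa using hadd (ι x) 0 0)
      refine ⟨v, hne.symm, fun x => ?_⟩
      have : M (ι (ι.symm x)) v = v := hv (ι.symm x)
      rwa [ι.apply_symm_apply] at this
  exact @key (ZMod p × ZMod p) (circleGroup hadd hmul hone hinv) (Equiv.refl _)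
    (fun _ _ => rfl) rfl

/-- Every brace on `(ℤ/p)²` has the form `x ∘ y = x + y + c x₂ y₂ e₁` in suitable coordinates. -/
lemma exists_coordinates {M : ZMod p × ZMod p → ZMod p × ZMod p → ZMod p × ZMod p}
    (hadd : ∀ x y z, M x (y + z) = M x y + M x z)
    (hmul : ∀ x y z, M (x + M x y) z = M x (M y z))
    (hone : ∀ y, M 0 y = y)
    (hinv : ∀ x, ∃ y, y + M y x = 0)
    (hinj : ∀ x y, M x y = 0 → y = 0) :
    ∃ (φ : (ZMod p × ZMod p) ≃+ (ZMod p × ZMod p)) (c : ZMod p),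
      ∀ x y, φ (M x y) = φ y + (c * (φ x).2 * (φ y).2, 0) := by
  obtain ⟨hcomm, v, hv, hfix⟩ := comm_and_exists_fixed hadd hmul hone hinv
  obtain ⟨φ, hφ⟩ := exists_addEquiv_apply_eq hv
  have hφ' : φ.symm (1, 0) = v := by rw [← hφ, φ.symm_apply_apply]
  obtain ⟨c, hc⟩ := exists_eq_of_fixes_fst (M := fun x y => φ (M (φ.symm x) (φ.symm y)))
    (fun x y z => by simp [hadd])
    (fun x y => φ.symm.injective (by simpa using hcomm (φ.symm x) (φ.symm y)))
    (fun x y z => by simp [hmul])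
    (fun x y h => by
      have := hinj _ _ (φ.map_eq_zero_iff.mp h)
      exact φ.symm.map_eq_zero_iff.mp this)
    (fun x => by simp only [hφ', hfix, hφ])
  exact ⟨φ, c, fun x y => by simpa using hc (φ x) (φ y)⟩

/-- Simultaneous normal form of a nontrivial brace on `(ℤ/p)²` and a brace involution. -/
lemma exists_coordinates_of_involution (h2 : (2 : ZMod p) ≠ 0)
    {M : ZMod p × ZMod p → ZMod p × ZMod p → ZMod p × ZMod p}
    {T : ZMod p × ZMod p → ZMod p × ZMod p}
    {φ : (ZMod p × ZMod p) ≃+ (ZMod p × ZMod p)} {c : ZMod p} (hc : c ≠ 0)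
    (hM : ∀ x y, φ (M x y) = φ y + (c * (φ x).2 * (φ y).2, 0))
    (hadd : ∀ x y, T (x + y) = T x + T y) (hT2 : ∀ x, T (T x) = x)
    (hT : ∃ x, T x ≠ x) (hTM : ∀ x y, T (M x y) = M (T x) (T y)) :
    ∃ ψ : (ZMod p × ZMod p) ≃+ (ZMod p × ZMod p),
      (∀ x y, ψ (M x y) = ψ y + ((ψ x).2 * (ψ y).2, 0)) ∧
      ∀ x, ψ (T x) = ((ψ x).1, -(ψ x).2) := by
  obtain ⟨S, hS⟩ : ∃ S : ZMod p × ZMod p → ZMod p × ZMod p, ∀ x, S x = φ (T (φ.symm x)) :=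
    ⟨_, fun _ => rfl⟩
  have hSφ : ∀ x, φ (T x) = S (φ x) := fun x => by simp [hS]
  have hSadd : ∀ x y, S (x + y) = S x + S y := fun x y => by simp [hS, hadd]
  have hS2 : ∀ x, S (S x) = x := fun x => by simp [hS, hT2]
  have hSsmul : ∀ (k : ZMod p) x, S (k • x) = k • S x := fun k x =>
    map_smul_of_map_add hSadd k x
  obtain ⟨b, d, hbd⟩ : ∃ b d, S (0, 1) = (b, d) := ⟨_, _, rfl⟩
  have hS10 : S (1, 0) = (d ^ 2, 0) := by
    have h := congrArg φ (hTM (φ.symm (0, 1)) (φ.symm (0, 1)))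
    rw [hSφ, hM, hM, hSφ] at h
    simp only [φ.apply_symm_apply, hSadd, hbd, mul_one] at h
    have h' : S (c, 0) = (c * d * d, 0) := add_left_cancel h
    have h3 : ((1, 0) : ZMod p × ZMod p) = c⁻¹ • (c, 0) := by simp [hc]
    rw [h3, hSsmul, h']
    ext
    · simp; field_simp
    · simp
  have hform : ∀ x, S x = (x.1 * d ^ 2 + x.2 * b, x.2 * d) := fun x => by
    have h1 : x = x.1 • ((1, 0) : ZMod p × ZMod p) + x.2 • ((0, 1) : ZMod p × ZMod p) := by
      ext <;> simp
    conv_lhs => rw [h1, hSadd, hSsmul, hSsmul, hbd, hS10]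
    ext <;> simp
  have h01 := hS2 (0, 1)
  simp only [hform, Prod.mk.injEq] at h01
  obtain ⟨hb, hd⟩ := h01
  have hdd : d ^ 2 = 1 := by linear_combination hd
  have hd' : d = -1 := by
    have h0 : (d - 1) * (d + 1) = 0 := by linear_combination hdd
    rcases mul_eq_zero.mp h0 with h | h
    · exfalso
      obtain ⟨x, hx⟩ := hT
      obtain rfl : d = 1 := sub_eq_zero.mp h
      have hb0 : b = 0 := by
        have : 2 * b = 0 := by linear_combination hb
        exact (mul_eq_zero.mp this).resolve_left h2
      exact hx (φ.injective (by rw [hSφ, hform, hb0]; ext <;> simp))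
    · exact eq_neg_of_add_eq_zero_left h
  subst hd'
  refine ⟨φ.trans ⟨⟨fun x => ((x.1 + b / 2 * x.2) / c, x.2), fun x => (x.1 * c - b / 2 * x.2, x.2),
      ?_, ?_⟩, ?_⟩, ?_, ?_⟩
  · intro x; ext <;> simp [hc]
  · intro x; ext <;> simp [hc]
  · intro x y
    ext
    · simp; ring
    · simp
  · intro x y
    ext
    · simp [hM]; field_simp; ring
    · simp [hM]
  · intro x
    ext
    · simp [hSφ, hform]; field_simp; ring
    · simp [hSφ, hform]

/-- A left brace on `(ℤ/p)² × ℤ/2` is determined by its part on `(ℤ/p)²`, with `λ`-map `M`, and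
by the action `T` of the element of additive order two. -/
lemma IsLeftBrace.exists_lambda (hpodd : Odd p) (h2 : (2 : ZMod p) ≠ 0)
    {h : ZMod p × ZMod p × ZMod 2 → ZMod p × ZMod p × ZMod 2 → ZMod p × ZMod p × ZMod 2}
    (hh : IsLeftBrace h) :
    ∃ (M : ZMod p × ZMod p → ZMod p × ZMod p → ZMod p × ZMod p)
      (T : ZMod p × ZMod p → ZMod p × ZMod p),
      (∀ x y z, M x (y + z) = M x y + M x z) ∧
      (∀ x y z, M (x + M x y) z = M x (M y z)) ∧
      (∀ y, M 0 y = y) ∧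
      (∀ x, ∃ y, y + M y x = 0) ∧
      (∀ x y, M x y = 0 → y = 0) ∧
      (∀ x y, T (x + y) = T x + T y) ∧
      (∀ x, T (T x) = x) ∧
      (∀ x y, T (M x y) = M (T x) (T y)) ∧
      (∀ x y : ZMod p × ZMod p, ∀ δ : ZMod 2, h (x.1, x.2, 0) (y.1, y.2, δ) =
        ((x + M x y).1, (x + M x y).2, δ)) ∧
      (∀ x y : ZMod p × ZMod p, ∀ δ : ZMod 2, h (x.1, x.2, 1) (y.1, y.2, δ) =
        ((x + M x (T y)).1, (x + M x (T y)).2, 1 + δ)) := by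
  obtain ⟨hassoc, hzl, hzr, hinv, hdist⟩ := hh
  obtain ⟨L, hL⟩ : ∃ L : ZMod p × ZMod p × ZMod 2 → ZMod p × ZMod p × ZMod 2 →
      ZMod p × ZMod p × ZMod 2, ∀ a b, L a b = h a b - a := ⟨_, fun _ _ => rfl⟩
  have hhL : ∀ a b, h a b = a + L a b := fun a b => by rw [hL]; abel
  have hLadd : ∀ a b c, L a (b + c) = L a b + L a c := fun a b c => by
    simp only [hL, hdist]; abel
  have hLmul : ∀ a b c, L (h a b) c = L a (L b c) := fun a b c => by
    have h1 := hassoc a b c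
    rw [hhL b c, hdist] at h1
    rw [hL (h a b), h1, hL a (L b c)]
    abel
  have hL0 : ∀ b, L 0 b = b := fun b => by rw [hL, hzl, sub_zero]
  have hLinj : ∀ a b, L a b = 0 → b = 0 := fun a b hab => by
    obtain ⟨a', ha'⟩ := hinv a
    have h1 := hLmul a' a b
    rw [ha', hL0, hab] at h1
    rw [h1]
    simpa using hLadd a' 0 0
  have hLnsmul : ∀ a (n : ℕ) b, L a (n • b) = n • L a b := fun a n b =>
    map_nsmul (AddMonoidHom.mk' (L a) (hLadd a)) n b
  have hLzero : ∀ a, L a 0 = 0 := fun a => by simpa using hLnsmul a 0 0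
  have hp1 : (p : ZMod 2) = 1 := by
    rw [ZMod.natCast_eq_one_iff_odd]; exact hpodd
  have hL3 : ∀ a (x : ZMod p × ZMod p), (L a (x.1, x.2, 0)).2.2 = 0 := fun a x => by
    have h1 := hLnsmul a p (x.1, x.2, 0)
    have h3 : p • ((x.1, x.2, 0) : ZMod p × ZMod p × ZMod 2) = 0 := by ext <;> simp
    rw [h3, hLzero] at h1
    have h4 := congrArg (fun v => v.2.2) h1
    simpa [hp1] using h4.symm
  have hLt : ∀ a, L a (0, 0, 1) = (0, 0, 1) := fun a => by
    have h1 := hLnsmul a 2 (0, 0, 1)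
    have h3 : 2 • ((0, 0, 1) : ZMod p × ZMod p × ZMod 2) = 0 := by
      ext
      · simp
      · simp
      · simp; rfl
    rw [h3, hLzero] at h1
    have h4 := congrArg (fun v => v.1) h1
    have h5 := congrArg (fun v => v.2.1) h1
    simp [h2] at h4 h5
    have h6 : (L a (0, 0, 1)).2.2 = 1 := by
      by_contra hne
      have h7 : ∀ z : ZMod 2, z ≠ 1 → z = 0 := by decide
      have := hLinj a (0, 0, 1) (by
        ext
        · simp [h4]
        · simp [h5]
        · exact h7 _ hne)
      simp at this
    ext
    · simp [h4]
    · simp [h5]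
    · exact h6
  have hLδ : ∀ a (δ : ZMod 2), L a (0, 0, δ) = (0, 0, δ) := fun a δ => by
    have h7 : δ = 0 ∨ δ = 1 := by revert δ; decide
    rcases h7 with rfl | rfl
    · exact hLzero a
    · exact hLt a
  obtain ⟨ι, hι⟩ : ∃ ι : ZMod p × ZMod p → ZMod p × ZMod p × ZMod 2,
      ∀ x, ι x = (x.1, x.2, 0) := ⟨_, fun _ => rfl⟩
  have hιinj : ∀ x y, ι x = ι y → x = y := fun x y hxy => by
    simp only [hι, Prod.mk.injEq] at hxy
    exact Prod.ext hxy.1 hxy.2.1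
  have hιadd : ∀ x y, ι (x + y) = ι x + ι y := fun x y => by simp [hι]
  have hι0 : ι 0 = 0 := by rw [hι]; rfl
  have hιsurj : ∀ a : ZMod p × ZMod p × ZMod 2, a.2.2 = 0 → ι (a.1, a.2.1) = a := fun a ha => by
    rw [hι, ← ha]
  obtain ⟨N, hN⟩ : ∃ N : ZMod p × ZMod p × ZMod 2 → ZMod p × ZMod p → ZMod p × ZMod p,
      ∀ a x, ι (N a x) = L a (ι x) :=
    ⟨fun a x => ((L a (ι x)).1, (L a (ι x)).2.1), fun a x => hιsurj _ (by rw [hι]; exact hL3 a x)⟩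
  have hιh : ∀ x y, h (ι x) (ι y) = ι (x + N (ι x) y) := fun x y => by rw [hhL, hιadd, hN]
  have hht : ∀ a, h a (0, 0, 1) = a + (0, 0, 1) := fun a => by rw [hhL, hLt]
  have hsplit : ∀ (x : ZMod p × ZMod p) (δ : ZMod 2), (x.1, x.2, δ) = ι x + (0, 0, δ) :=
    fun x δ => by simp [hι]
  have hNadd : ∀ a x y, N a (x + y) = N a x + N a y := fun a x y =>
    hιinj _ _ (by simp only [hN, hιadd, hLadd])
  refine ⟨fun x => N (ι x), N (0, 0, 1), fun x => hNadd _, ?_, ?_, ?_, ?_, hNadd _, ?_, ?_, ?_, ?_⟩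
  · intro x y z
    exact hιinj _ _ (by rw [hN, ← hιh, hLmul, hN, hN])
  · intro y
    exact hιinj _ _ (by rw [hN, hι0, hL0])
  · intro x
    obtain ⟨a, ha⟩ := hinv (ι x)
    have ha3 : a.2.2 = 0 := by
      have h4 := congrArg (fun v => v.2.2) ha
      rw [hhL, hι] at h4
      simpa [hL3] using h4
    refine ⟨(a.1, a.2.1), hιinj _ _ ?_⟩
    rw [← hιh, hιsurj a ha3, ha, hι0]
  · intro x y hxy
    apply hιinj
    rw [hι0]
    apply hLinj (ι x)
    rw [← hN]
    exact (congrArg ι hxy).trans hι0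
  · intro x
    apply hιinj
    rw [hN, hN, ← hLmul, hht]
    have h3 : ((0, 0, 1) : ZMod p × ZMod p × ZMod 2) + (0, 0, 1) = 0 := by
      ext
      · simp
      · simp
      · simp; rfl
    rw [h3, hL0]
  · intro x y
    apply hιinj
    rw [hN, hN, hN, hN (0, 0, 1) y, ← hLmul, ← hLmul, hht, hhL, hN, add_comm]
  · intro x y δ
    rw [hsplit x 0, hsplit y δ, hsplit _ δ]
    have h0 : ((0, 0, 0) : ZMod p × ZMod p × ZMod 2) = 0 := rfl
    rw [h0, add_zero, hhL, hLadd, hLδ, ← hN, hιadd, add_assoc]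
  · intro x y δ
    have hδ : ((0, 0, 1 + δ) : ZMod p × ZMod p × ZMod 2) = (0, 0, 1) + (0, 0, δ) := by simp
    rw [hsplit x 1, hsplit y δ, hsplit _ (1 + δ), ← hht, hhL, hLadd, hLδ, hLmul, ← hN, ← hN,
      hιadd, hht, hδ]
    abel

/-- A left brace on `(ℤ/p)² × ℤ/2` whose `λ` has kernel of order `p` is isomorphic to the one
given by `circ11`. -/
lemma IsLeftBrace.exists_equiv_circ11 (hpodd : Odd p)
    {h : ZMod p × ZMod p × ZMod 2 → ZMod p × ZMod p × ZMod 2 → ZMod p × ZMod p × ZMod 2}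
    (hh : IsLeftBrace h) (hcard : Nat.card ↥(kerLambda h) = p) (h2 : (2 : ZMod p) ≠ 0) :
    ∃ e : ZMod p × ZMod p × ZMod 2 ≃ ZMod p × ZMod p × ZMod 2,
      (∀ a b, e (a + b) = e a + e b) ∧ ∀ a b, e (h a b) = circ11 p (e a) (e b) := by
  obtain ⟨M, T, hadd, hmul, hone, hinv, hinj, hTadd, hT2, hTM, hh0, hh1⟩ :=
    hh.exists_lambda hpodd h2
  obtain ⟨φ, c, hM⟩ := exists_coordinates hadd hmul hone hinv hinj
  have hmem : ∀ x : ZMod p × ZMod p, (∀ y, M x y = y) → (x.1, x.2, 0) ∈ kerLambda h := by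
    intro x hx b
    have := hh0 x (b.1, b.2.1) b.2.2
    rw [hx] at this
    rw [this]
    ext <;> simp
  obtain ⟨s, hs⟩ : ∃ s : ZMod p → ZMod p × ZMod p × ZMod 2,
      ∀ k, s k = ((φ.symm (k, 0)).1, (φ.symm (k, 0)).2, 0) := ⟨_, fun _ => rfl⟩
  have hsinj : Function.Injective s := fun k l hkl => by
    simp only [hs, Prod.mk.injEq] at hkl
    have := φ.symm.injective (Prod.ext hkl.1 hkl.2.1)
    exact (Prod.mk.inj this).1
  have hrange : Set.range s = kerLambda h := by
    apply Set.eq_of_subset_of_ncard_le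
    · rintro _ ⟨k, rfl⟩
      rw [hs]
      exact hmem _ fun y => φ.injective (by rw [hM]; ext <;> simp)
    · rw [← Nat.card_coe_set_eq, hcard, ← Nat.card_coe_set_eq, Nat.card_range_of_injective hsinj,
        Nat.card_zmod]
    · exact Set.toFinite _
  have hc : c ≠ 0 := by
    rintro rfl
    have := hmem (φ.symm (0, 1)) fun y => φ.injective (by rw [hM]; ext <;> simp)
    rw [← hrange] at this
    obtain ⟨k, hk⟩ := this
    simp only [hs, Prod.mk.injEq] at hk
    have := φ.symm.injective (Prod.ext hk.1 hk.2.1)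
    simp at this
  have hT : ∃ x, T x ≠ x := by
    by_contra! hT
    have : ((0, 0, 1) : ZMod p × ZMod p × ZMod 2) ∈ kerLambda h := fun b => by
      have := hh1 0 (b.1, b.2.1) b.2.2
      rw [hT, hone] at this
      refine Eq.trans this ?_
      ext <;> simp
    rw [← hrange] at this
    obtain ⟨k, hk⟩ := this
    simp [hs] at hk
  obtain ⟨ψ, hψM, hψT⟩ := exists_coordinates_of_involution h2 hc hM hTadd hT2 hT hTM
  refine ⟨⟨fun v => ((ψ (v.1, v.2.1)).1, (ψ (v.1, v.2.1)).2, v.2.2),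
    fun v => ((ψ.symm (v.1, v.2.1)).1, (ψ.symm (v.1, v.2.1)).2, v.2.2), fun v => by simp,
    fun v => by simp⟩, ?_, ?_⟩
  · rintro ⟨a1, a2, a3⟩ ⟨b1, b2, b3⟩
    have : ψ (a1 + b1, a2 + b2) = ψ (a1, a2) + ψ (b1, b2) := by rw [← map_add]; rfl
    simp [this]
  · have hψadd : ∀ v w, ψ ((v + w).1, (v + w).2) = ψ v + ψ w := fun v w => map_add ψ v w
    rintro ⟨a1, a2, a3⟩ ⟨b1, b2, b3⟩
    have h7 : a3 = 0 ∨ a3 = 1 := by revert a3; decide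
    rcases h7 with rfl | rfl
    · have := hh0 (a1, a2) (b1, b2) b3
      simp only at this
      simp only [this, circ11, Equiv.coe_fn_mk, hψadd, hψM]
      ext
      · simp; ring
      · simp
      · simp
    · have := hh1 (a1, a2) (b1, b2) b3
      simp only at this
      have hv : (1 : ZMod 2).val = 1 := rfl
      simp only [this, circ11, Equiv.coe_fn_mk, hψadd, hψM, hψT, hv]
      ext
      · simp; ring
      · simp
      · simp

/-- The sign `(-1)^ε` for `ε : ℤ/2` is multiplicative. -/
lemma neg_one_pow_val_add (a b : ZMod 2) :
    (-1 : ZMod p) ^ (a + b).val = (-1) ^ a.val * (-1) ^ b.val := by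
  rw [ZMod.val_add, ← neg_one_pow_eq_pow_mod_two, pow_add]

lemma neg_one_pow_val_mul_self (a : ZMod 2) : (-1 : ZMod p) ^ a.val * (-1) ^ a.val = 1 := by
  rw [← mul_pow]; simp

lemma isLeftBrace_circ11 : IsLeftBrace (circ11 p) := by
  refine ⟨?_, ?_, ?_, ?_, ?_⟩
  · intro a b c
    have h := neg_one_pow_val_mul_self (p := p) a.2.2
    ext
    · simp only [circ11, neg_one_pow_val_add]
      linear_combination (-1 : ZMod p) ^ b.2.2.val * b.2.1 * c.2.1 * h
    · simp only [circ11, neg_one_pow_val_add]; ring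
    · simp [circ11, add_assoc]
  · intro a; ext <;> simp [circ11]
  · intro a; ext <;> simp [circ11]
  · intro a
    have h := neg_one_pow_val_mul_self (p := p) a.2.2
    refine ⟨(-a.1 + a.2.1 * a.2.1, -(-1) ^ a.2.2.val * a.2.1, a.2.2), ?_⟩
    ext
    · simp only [circ11, Prod.fst_zero]
      linear_combination (-a.2.1 * a.2.1) * h
    · simp only [circ11, Prod.fst_zero, Prod.snd_zero]; ring
    · simp only [circ11, Prod.snd_zero]
      exact CharTwo.add_self_eq_zero _
  · intro a b c
    ext
    · simp [circ11]; ring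
    · simp [circ11]; ring
    · simp [circ11]; abel

lemma card_kerLambda_circ11 (h2 : (2 : ZMod p) ≠ 0) :
    Nat.card ↥(kerLambda (circ11 p)) = p := by
  have hrange : kerLambda (circ11 p) =
      Set.range fun k : ZMod p => ((k, 0, 0) : ZMod p × ZMod p × ZMod 2) := by
    ext ⟨a1, a2, a3⟩
    constructor
    · have h7 : a3 = 0 ∨ a3 = 1 := by revert a3; decide
      intro h
      have h1 := h (0, 1, 0)
      rcases h7 with rfl | rfl
      · simp [circ11] at h1
        exact ⟨a1, by simp [h1]⟩
      · have hv : (1 : ZMod 2).val = 1 := rfl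
        simp [circ11, hv] at h1
        exact absurd (by linear_combination -h1.2) h2
    · rintro ⟨k, hk⟩ b
      rw [← hk]
      ext <;> simp [circ11]
  rw [hrange, Nat.card_range_of_injective fun k l h => (Prod.mk.inj h).1, Nat.card_zmod]

lemma exists_equiv_dihedralGroup (h2 : (2 : ZMod p) ≠ 0) :
    ∃ e : ZMod p × ZMod p × ZMod 2 ≃ Multiplicative (ZMod p) × DihedralGroup p,
      ∀ a b, e (circ11 p a b) = e a * e b := by
  obtain ⟨f, hf⟩ : ∃ f : ZMod p × ZMod p × ZMod 2 → Multiplicative (ZMod p) × DihedralGroup p,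
      ∀ x, f x = (Multiplicative.ofAdd (x.1 - x.2.1 ^ 2 / 2),
        if x.2.2 = 0 then DihedralGroup.r x.2.1 else DihedralGroup.sr (-x.2.1)) :=
    ⟨_, fun _ => rfl⟩
  have hv : (1 : ZMod 2).val = 1 := rfl
  have h11 : (1 : ZMod 2) + 1 = 0 := rfl
  have h01 : ∀ a : ZMod 2, a = 0 ∨ a = 1 := by decide
  have hbij : Function.Bijective f := by
    constructor
    · rintro ⟨a1, a2, a3⟩ ⟨b1, b2, b3⟩ hab
      rcases h01 a3 with rfl | rfl <;> rcases h01 b3 with rfl | rfl <;>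
        simp [hf] at hab ⊢ <;> obtain ⟨h1, rfl⟩ := hab <;> simpa using h1
    · rintro ⟨k, i | i⟩
      · exact ⟨(k.toAdd + i ^ 2 / 2, i, 0), by simp [hf]⟩
      · exact ⟨(k.toAdd + i ^ 2 / 2, -i, 1), by simp [hf]⟩
  refine ⟨Equiv.ofBijective f hbij, ?_⟩
  rintro ⟨a1, a2, a3⟩ ⟨b1, b2, b3⟩
  simp only [Equiv.ofBijective_apply, hf]
  refine Prod.ext ?_ ?_
  · simp only [Prod.fst_mul, ← ofAdd_add]
    congr 1
    have h := neg_one_pow_val_mul_self (p := p) a3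
    simp only [circ11]
    field_simp
    linear_combination (-b2 ^ 2) * h
  · rcases h01 a3 with rfl | rfl <;> rcases h01 b3 with rfl | rfl <;>
      simp [circ11, hv, h11] <;> ring

end PrimeSquare

/-- Let `p` be an odd prime.  On `B = ℤ/p × ℤ/p × ℤ/2` the displayed operation makes
`(B,+,∘)` a left brace with `|ker λ| = p`; `(B,∘)` is isomorphic to `ℤ/p × D_{2p}`
with `D_{2p}` the dihedral group of order `2p`; and up to brace isomorphism it is the
unique left brace with additive group `ℤ/p × ℤ/p × ℤ/2` and `|ker λ| = p`. -/
theorem stmt_11 (p : ℕ) (hp : p.Prime) (hpodd : Odd p) :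
    IsLeftBrace (circ11 p) ∧
    Nat.card ↥(kerLambda (circ11 p)) = p ∧
    (∃ e : ZMod p × ZMod p × ZMod 2 ≃ Multiplicative (ZMod p) × DihedralGroup p,
      ∀ a b, e (circ11 p a b) = e a * e b) ∧
    (∀ h : ZMod p × ZMod p × ZMod 2 → ZMod p × ZMod p × ZMod 2 → ZMod p × ZMod p × ZMod 2,
      IsLeftBrace h → Nat.card ↥(kerLambda h) = p →
      ∃ e : ZMod p × ZMod p × ZMod 2 ≃ ZMod p × ZMod p × ZMod 2,
        (∀ a b, e (a + b) = e a + e b) ∧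
        ∀ a b, e (h a b) = circ11 p (e a) (e b)) := by
  have : Fact p.Prime := ⟨hp⟩
  have h2 : (2 : ZMod p) ≠ 0 := by
    refine Ring.two_ne_zero ?_
    rw [ZMod.ringChar_zmod_n]
    rintro rfl
    exact absurd hpodd (by decide)
  exact ⟨isLeftBrace_circ11, card_kerLambda_circ11 h2, exists_equiv_dihedralGroup h2,
    fun _ hh hcard => hh.exists_equiv_circ11 hpodd hcard h2⟩
end
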